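/- Assume p is odd, n is odd, and n is a multiple of t/r. Let α, β ∈ 𝔽_q with α ≠ 0 and α + β ≠ 0, and suppose there exist δ, γ ∈ 𝔽_q^* with α = δ^{[n]} and α + β = γ^{[n]}. Set u = vγ + (1−v)δ ∈ R^*. Then the monomial map Ψ_{−u} : Rⁿ → Rⁿ, (c₀,…,c_{n−1}) ↦ ((−u)^{[0]}c₀, (−u)^{[1]}c₁, …, (−u)^{[n−1]}c_{n−1}), is an R-linear Hamming-weight-preserving bijection that maps the set of skew (α+vβ)-constacyclic codes of length n over R (with respect to θ_r) bijectively onto the set of skew negacyclic codes of length n over R; in particular every skew (α+vβ)-constacyclic code of length n over R is equivalent to a skew negacyclic code of length n over R. -/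

import Mathlib

open scoped BigOperators

/-- The ring `R = 𝔽_q + v 𝔽_q`, `v² = v`, realized concretely as `F × F`
via the `F`-algebra isomorphism `a + v b ↦ (a, a + b)`. -/
abbrev Rg (F : Type) := F × F

/-- The element `v` of `R`: under the identification above, `v = (0, 1)`. -/
def vv (F : Type) [Field F] : Rg F := (0, 1)

/-- The element `v • x + (1 - v) • y` of `Rⁿ`, for `x, y ∈ Fⁿ`. -/
def mix {F : Type} [Field F] {n : ℕ} (x y : Fin n → F) : Fin n → Rg F :=
  fun i => vv F * algebraMap F (Rg F) (x i) + (1 - vv F) * algebraMap F (Rg F) (y i)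

/-- `v A ⊕ (1 - v) B = {v a + (1-v) b : a ∈ A, b ∈ B}`. -/
def mixSet {F : Type} [Field F] {n : ℕ} (A B : Set (Fin n → F)) : Set (Fin n → Rg F) :=
  {c | ∃ x ∈ A, ∃ y ∈ B, c = mix x y}

/-- Euclidean dual (of an arbitrary subset). -/
def dualE {K : Type} [CommRing K] {n : ℕ} (C : Set (Fin n → K)) : Set (Fin n → K) :=
  {x | ∀ y ∈ C, ∑ i, x i * y i = 0}

/-- Hermitian dual w.r.t. a conjugation map. -/
def dualH {K : Type} [CommRing K] (conj : K → K) {n : ℕ} (C : Set (Fin n → K)) :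
    Set (Fin n → K) :=
  {x | ∀ y ∈ C, ∑ i, x i * conj (y i) = 0}

/-- The map `a + v b ↦ a ^ e + v * b ^ e` on `R` (i.e. the extension of `x ↦ x ^ e`
from `F` to `R`); used for `θ_r` (`e = p ^ r`) and for conjugation (`e = p ^ (t/2)`). -/
def thR (F : Type) [Field F] (e : ℕ) : Rg F → Rg F :=
  fun z => (z.1 ^ e, z.1 ^ e + (z.2 - z.1) ^ e)

/-- The skew `λ`-constacyclic shift
`(c₀, …, c_{n-1}) ↦ (λ θ(c_{n-1}), θ(c₀), …, θ(c_{n-2}))`. -/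
def skewShift {K : Type} [Mul K] (th : K → K) (lam : K) {n : ℕ} (c : Fin n → K) :
    Fin n → K :=
  fun i =>
    if (i : ℕ) = 0 then
      lam * th (c ⟨n - 1, Nat.sub_lt (Nat.lt_of_le_of_lt (Nat.zero_le _) i.isLt) Nat.one_pos⟩)
    else th (c ⟨(i : ℕ) - 1, Nat.lt_of_le_of_lt (Nat.sub_le _ _) i.isLt⟩)

/-- A set of words is skew `λ`-constacyclic if it is stable under the skew shift. -/
def SkewConsta {K : Type} [Mul K] (th : K → K) (lam : K) {n : ℕ}
    (C : Set (Fin n → K)) : Prop :=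
  ∀ c ∈ C, skewShift th lam c ∈ C

/-- `[i] = (p^{ri} - 1)/(p^r - 1) = 1 + p^r + ⋯ + p^{r(i-1)}` (so `[0] = 0`). -/
def brk (p r i : ℕ) : ℕ := ∑ j ∈ Finset.range i, p ^ (r * j)

/-- The monomial map `ψ_δ : (c₀, …, c_{n-1}) ↦ (δ^{[0]} c₀, …, δ^{[n-1]} c_{n-1})`. -/
def psi {K : Type} [Monoid K] (p r : ℕ) (δ : K) {n : ℕ} (c : Fin n → K) : Fin n → K :=
  fun i => δ ^ brk p r (i : ℕ) * c i

/-- A set is a linear code over `K` if it is (the carrier of) a `K`-submodule. -/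
def IsLinCode (K : Type) [Semiring K] {M : Type} [AddCommMonoid M] [Module K M]
    (S : Set M) : Prop :=
  ∃ C : Submodule K M, ↑C = S

/-- The Gray map `Φ(a + v b) = (a, a + b)`, componentwise; under the identification
`R = F × F` it is the canonical unzip `Rⁿ ≅ Fⁿ × Fⁿ`. -/
def gray {F : Type} [Field F] {n : ℕ} (c : Fin n → Rg F) : (Fin n → F) × (Fin n → F) :=
  (fun i => (c i).1, fun i => (c i).2)

/-- Euclidean dual in `F^{2n} ≅ Fⁿ × Fⁿ` w.r.t. the standard inner product. -/
def dualProd {F : Type} [Field F] {n : ℕ} (S : Set ((Fin n → F) × (Fin n → F))) :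
    Set ((Fin n → F) × (Fin n → F)) :=
  {x | ∀ y ∈ S, (∑ i, x.1 i * y.1 i) + (∑ i, x.2 i * y.2 i) = 0}

theorem brk_succ (p r i : ℕ) : brk p r (i + 1) = 1 + p ^ r * brk p r i := by
  simp only [brk]
  rw [Finset.sum_range_succ', Finset.mul_sum, add_comm]
  congr 1
  refine Finset.sum_congr rfl fun j _ => ?_
  rw [← pow_add]
  congr 1
  ring

theorem odd_brk {p n : ℕ} (r : ℕ) (hp : Odd p) (hn : Odd n) : Odd (brk p r n) := by
  rw [brk, Finset.odd_sum_iff_odd_card_odd]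
  simpa [hp.pow] using hn

theorem isLinearMap_psi {K : Type} [CommSemiring K] (p r n : ℕ) (w : K) :
    IsLinearMap K (psi p r w (n := n)) where
  map_add x y := by
    ext i
    simp [psi, mul_add]
  map_smul a x := by
    ext i
    simp [psi, mul_left_comm]

theorem bijective_psi {K : Type} [Monoid K] (p r n : ℕ) {w : K} (hw : IsUnit w) :
    Function.Bijective (psi p r w (n := n)) := by
  constructor
  · intro x y h
    ext i
    exact (hw.pow (brk p r i)).mul_left_cancel (congrFun h i)
  · intro y
    refine ⟨fun i => ↑((hw.pow (brk p r i)).unit⁻¹) * y i, ?_⟩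
    ext i
    rw [psi, ← mul_assoc, IsUnit.mul_val_inv, one_mul]

theorem hammingNorm_psi {K : Type} [Semiring K] [DecidableEq K] (p r : ℕ) {n : ℕ} {w : K}
    (hw : IsUnit w) (x : Fin n → K) : hammingNorm (psi p r w x) = hammingNorm x := by
  simp only [hammingNorm, psi, ne_eq, (hw.pow _).mul_right_eq_zero]

/-- When `th` is the power map `x ↦ x ^ p ^ r`, the map `psi` intertwines the skew
`w ^ [n] * μ`-shift with `w` times the skew `μ`-shift. -/
theorem psi_skewShift {K : Type} [CommRing K] (p r : ℕ) {n : ℕ} {th : K → K}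
    (hth : ∀ x, th x = x ^ p ^ r) (w μ : K) (c : Fin n → K) :
    psi p r w (skewShift th (w ^ brk p r n * μ) c) = w • skewShift th μ (psi p r w c) := by
  ext ⟨i, hi⟩
  cases i with
  | zero =>
    obtain ⟨m, rfl⟩ : ∃ m, n = m + 1 := ⟨n - 1, by omega⟩
    simp only [psi, skewShift, hth, Pi.smul_apply, smul_eq_mul, if_true, brk_succ,
      Nat.add_sub_cancel]
    simp only [brk, Finset.range_zero, Finset.sum_empty]
    ring
  | succ i =>
    simp only [psi, skewShift, hth, Pi.smul_apply, smul_eq_mul, brk_succ, Nat.add_sub_cancel,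
      Nat.succ_ne_zero, if_false]
    ring

theorem bijOn_image_psi {K : Type} [CommRing K] (p r n : ℕ) {th : K → K}
    (hth : ∀ x, th x = x ^ p ^ r) {w : K} (hw : IsUnit w) (μ : K) :
    Set.BijOn (Set.image (psi p r w))
      {S : Set (Fin n → K) | IsLinCode K S ∧ SkewConsta th (w ^ brk p r n * μ) S}
      {S : Set (Fin n → K) | IsLinCode K S ∧ SkewConsta th μ S} := by
  have hbij := bijective_psi p r n hw
  have hlin := isLinearMap_psi p r n w
  refine ⟨?_, hbij.1.image_injective.injOn, ?_⟩
  · rintro _ ⟨⟨C, rfl⟩, hC⟩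
    refine ⟨⟨C.map (hlin.mk' _), rfl⟩, ?_⟩
    rintro _ ⟨c, hc, rfl⟩
    refine ⟨(↑hw.unit⁻¹ : K) • skewShift th (w ^ brk p r n * μ) c,
      C.smul_mem _ (hC c hc), ?_⟩
    rw [hlin.map_smul, psi_skewShift p r hth, smul_smul, hw.val_inv_mul, one_smul]
  · rintro _ ⟨⟨C, rfl⟩, hC⟩
    refine ⟨psi p r w ⁻¹' C, ⟨⟨C.comap (hlin.mk' _), rfl⟩, ?_⟩,
      Set.image_preimage_eq _ hbij.2⟩
    intro c hc
    rw [Set.mem_preimage, psi_skewShift p r hth]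
    exact C.smul_mem w (hC _ hc)

theorem thR_eq_pow {F : Type} [Field F] (p r : ℕ) [ExpChar F p] (z : Rg F) :
    thR F (p ^ r) z = z ^ p ^ r := by
  ext
  · rfl
  · simp [thR, sub_pow_expChar_pow]

/-- for `p`, `n` odd, with `α = δ^{[n]}`, `α + β = γ^{[n]}` and
`u = vγ + (1-v)δ`, the monomial map `Ψ_{-u}` is an `R`-linear Hamming-weight-preserving
bijection mapping the set of skew `(α + vβ)`-constacyclic codes of length `n` over `R`
bijectively onto the set of skew negacyclic codes of length `n` over `R`. -/
theorem stmt9 (p t r n : ℕ) (hp : p.Prime) (hpodd : Odd p) (ht : 0 < t) (hr : r ∣ t)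
    (hnodd : Odd n) (hn : (t / r) ∣ n)
    (F : Type) [Field F] [Fintype F] [DecidableEq F] (hF : Fintype.card F = p ^ t)
    (α β δ γ : F) (hα : α ≠ 0) (hαβ : α + β ≠ 0) (hδ : δ ≠ 0) (hγ : γ ≠ 0)
    (hαδ : α = δ ^ brk p r n) (hαβγ : α + β = γ ^ brk p r n)
    (u : Rg F)
    (hu : u = vv F * algebraMap F (Rg F) γ + (1 - vv F) * algebraMap F (Rg F) δ) :
    IsLinearMap (Rg F) (psi p r (-u) (n := n)) ∧
    Function.Bijective (psi p r (-u) (n := n)) ∧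
    (∀ x : Fin n → Rg F, hammingNorm (psi p r (-u) x) = hammingNorm x) ∧
    Set.BijOn (Set.image (psi p r (-u)))
      {S : Set (Fin n → Rg F) | IsLinCode (Rg F) S ∧
        SkewConsta (thR F (p ^ r))
          (algebraMap F (Rg F) α + vv F * algebraMap F (Rg F) β) S}
      {S : Set (Fin n → Rg F) | IsLinCode (Rg F) S ∧
        SkewConsta (thR F (p ^ r)) (-1 : Rg F) S} := by
  have : Fact p.Prime := ⟨hp⟩
  have : CharP F p := charP_of_card_eq_prime_pow hF
  have : ExpChar F p := ExpChar.prime hp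
  have hu' : u = (δ, γ) := by
    rw [hu]
    ext <;> simp [vv]
  have hw : IsUnit (-u) := by
    rw [IsUnit.neg_iff, hu', Prod.isUnit_iff]
    exact ⟨hδ.isUnit, hγ.isUnit⟩
  have hunit : algebraMap F (Rg F) α + vv F * algebraMap F (Rg F) β =
      (-u) ^ brk p r n * -1 := by
    rw [(odd_brk r hpodd hnodd).neg_pow, neg_mul_neg, mul_one, hu']
    ext
    · simp [vv, ← hαδ]
    · simp [vv, ← hαβγ]
  rw [hunit]
  exact ⟨isLinearMap_psi p r n _, bijective_psi p r n hw, hammingNorm_psi p r hw,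
    bijOn_image_psi p r n (thR_eq_pow p r) hw _⟩
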